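/- arXiv:2503.01707 — 2 statements merged into one kernel-verified Lean document; each statement's English description precedes it below -/
import Mathlib

section
/- Let d ≥ 2, let g ∈ ℝ^d be nonzero, set e := g/‖g‖ and δ(t) := t‖g‖/(d-1). Let Π₀ ∈ ℝ^d be nonzero, set u₀ := Π₀/‖Π₀‖, and define Π(t) := Π₀ + ‖Π₀‖·(sinh δ(t) + ⟨e,u₀⟩(cosh δ(t) - 1)) • e. Then (i) Π(0) = Π₀; (ii) ‖Π(t)‖ = ‖Π₀‖·(cosh δ(t) + ⟨e,u₀⟩ sinh δ(t)) for all t; (iii) Π'(t) = (‖Π(t)‖/(d-1)) • g for all t. Consequently the kinetic energy K(Π) = (d-1) log‖Π‖ changes by K(Π(t)) - K(Π₀) = (d-1)·log(cosh δ(t) + ⟨e,u₀⟩ sinh δ(t)). -/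
open scoped RealInnerProductSpace

section Helpers

variable {E : Type*} [NormedAddCommGroup E] [InnerProductSpace ℝ E]

theorem Real.cosh_add_mul_sinh_pos {c : ℝ} (hc : |c| ≤ 1) (x : ℝ) :
    0 < Real.cosh x + c * Real.sinh x := by
  obtain ⟨h₁, h₂⟩ := abs_le.mp hc
  rw [Real.cosh_eq, Real.sinh_eq]
  nlinarith [mul_nonneg (sub_nonneg.mpr h₂) (Real.exp_pos (-x)).le,
    mul_nonneg (neg_le_iff_add_nonneg.mp h₁) (Real.exp_pos x).le,
    Real.exp_pos x, Real.exp_pos (-x)]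

/-- The norm of a unit vector `u` moved along a unit vector `e` by the hyperbolic update. -/
theorem norm_add_hyperbolic_smul {e u : E} (he : ‖e‖ = 1) (hu : ‖u‖ = 1) (x : ℝ) :
    ‖u + (Real.sinh x + ⟪e, u⟫ * (Real.cosh x - 1)) • e‖ =
      Real.cosh x + ⟪e, u⟫ * Real.sinh x := by
  have hc : |⟪e, u⟫| ≤ 1 := by
    simpa [he, hu] using abs_real_inner_le_norm e u
  rw [← sq_eq_sq₀ (norm_nonneg _) (Real.cosh_add_mul_sinh_pos hc x).le, norm_add_sq_real,
    norm_smul, inner_smul_right, real_inner_comm e u, he, hu, mul_one, Real.norm_eq_abs, sq_abs]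
  linear_combination (⟪e, u⟫ ^ 2 - 1) * Real.cosh_sq x

end Helpers

/-- Explicit solution of the momentum half of the time-rescaled microcanonical
Hamiltonian system with frozen gradient: `Π̇ = ‖Π‖ g / (d-1)`. The kinetic
energy `K(Π) = (d-1) log ‖Π‖` changes by `(d-1) log(cosh δ + ⟨e,u₀⟩ sinh δ)`. -/
theorem momentum_update_explicit {d : ℕ} (hd : 2 ≤ d)
    (g : EuclideanSpace ℝ (Fin d)) (hg : g ≠ 0)
    (e : EuclideanSpace ℝ (Fin d)) (he : e = ‖g‖⁻¹ • g)
    (δ : ℝ → ℝ) (hδ : ∀ t, δ t = t * ‖g‖ / ((d : ℝ) - 1))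
    (P₀ : EuclideanSpace ℝ (Fin d)) (hP₀ : P₀ ≠ 0)
    (u₀ : EuclideanSpace ℝ (Fin d)) (hu₀ : u₀ = ‖P₀‖⁻¹ • P₀)
    (P : ℝ → EuclideanSpace ℝ (Fin d))
    (hP : ∀ t, P t = P₀ +
      (‖P₀‖ * (Real.sinh (δ t) + ⟪e, u₀⟫ * (Real.cosh (δ t) - 1))) • e) :
    P 0 = P₀ ∧
    (∀ t, ‖P t‖ = ‖P₀‖ * (Real.cosh (δ t) + ⟪e, u₀⟫ * Real.sinh (δ t))) ∧
    (∀ t, HasDerivAt P ((‖P t‖ / ((d : ℝ) - 1)) • g) t) ∧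
    (∀ t, ((d : ℝ) - 1) * Real.log ‖P t‖ - ((d : ℝ) - 1) * Real.log ‖P₀‖ =
      ((d : ℝ) - 1) * Real.log (Real.cosh (δ t) + ⟪e, u₀⟫ * Real.sinh (δ t))) := by
  have hgn : ‖g‖ ≠ 0 := norm_ne_zero_iff.mpr hg
  have hPn : ‖P₀‖ ≠ 0 := norm_ne_zero_iff.mpr hP₀
  have he1 : ‖e‖ = 1 := by rw [he]; exact norm_smul_inv_norm (𝕜 := ℝ) hg
  have hu1 : ‖u₀‖ = 1 := by rw [hu₀]; exact norm_smul_inv_norm (𝕜 := ℝ) hP₀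
  have hc : |⟪e, u₀⟫| ≤ 1 := by
    simpa [he1, hu1] using abs_real_inner_le_norm e u₀
  have hnorm : ∀ t, ‖P t‖ = ‖P₀‖ * (Real.cosh (δ t) + ⟪e, u₀⟫ * Real.sinh (δ t)) := by
    intro t
    have hPt : P t =
        ‖P₀‖ • (u₀ + (Real.sinh (δ t) + ⟪e, u₀⟫ * (Real.cosh (δ t) - 1)) • e) := by
      have hP₀u : ‖P₀‖ • u₀ = P₀ := by rw [hu₀, smul_inv_smul₀ hPn]
      rw [smul_add, smul_smul, hP₀u, hP]
    rw [hPt, norm_smul, norm_norm, norm_add_hyperbolic_smul he1 hu1]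
  refine ⟨by simp [hP, hδ], hnorm, fun t => ?_, fun t => ?_⟩
  · have hδ' : HasDerivAt δ (‖g‖ / ((d : ℝ) - 1)) t := by
      rw [funext hδ]
      simpa using ((hasDerivAt_id t).mul_const ‖g‖).div_const ((d : ℝ) - 1)
    have hge : g = ‖g‖ • e := by rw [he, smul_inv_smul₀ hgn]
    have hderiv := (((hδ'.sinh.add ((hδ'.cosh.sub_const 1).const_mul ⟪e, u₀⟫)).const_mul
      ‖P₀‖).smul_const e).const_add P₀
    rw [hnorm t]
    nth_rewrite 1 [hge]
    rw [smul_smul, funext hP]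
    refine hderiv.congr_deriv ?_
    congr 1
    ring
  · rw [hnorm t, Real.log_mul hPn (Real.cosh_add_mul_sinh_pos hc _).ne']
    ring
end

section
/- Fix d ≥ 2, δ ∈ ℝ, θ ∈ (0, π), and let θ'(θ) := arccos( (sinh δ + cos θ · cosh δ) / (cosh δ + cos θ · sinh δ) ). Then (sin θ'(θ) / sin θ)^{d-2} · (dθ'/dθ)(θ) = (cosh δ + cos θ · sinh δ)^{-(d-1)}. Equivalently, the Metropolis–Hastings log-ratio of the microcanonical velocity update, W = -log[(density ratio)·(Jacobian)], equals (d-1)·log(cosh δ + cos θ sinh δ), which is the kinetic energy change of the update. -/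
open Real in
theorem cosh_add_mul_sinh_pos {c : ℝ} (δ : ℝ) (hc : c ∈ Set.Icc (-1 : ℝ) 1) :
    0 < cosh δ + c * sinh δ := by
  rw [cosh_eq, sinh_eq]
  nlinarith [mul_nonneg (by linarith [hc.1] : 0 ≤ 1 + c) (exp_pos δ).le,
    mul_nonneg (by linarith [hc.2] : 0 ≤ 1 - c) (exp_pos (-δ)).le,
    exp_pos δ, exp_pos (-δ)]

open Real in
theorem sqrt_one_sub_angular_update_sq (δ : ℝ) {θ : ℝ} (hθ : θ ∈ Set.Icc 0 π) :
    √(1 - ((sinh δ + cos θ * cosh δ) / (cosh δ + cos θ * sinh δ)) ^ 2) =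
      sin θ / (cosh δ + cos θ * sinh δ) := by
  have hD := cosh_add_mul_sinh_pos δ (cos_mem_Icc θ)
  have h : 1 - ((sinh δ + cos θ * cosh δ) / (cosh δ + cos θ * sinh δ)) ^ 2 =
      (sin θ / (cosh δ + cos θ * sinh δ)) ^ 2 := by
    rw [div_pow, div_pow, sin_sq, eq_div_iff (by positivity), sub_mul,
      div_mul_cancel₀ _ (by positivity)]
    linear_combination (1 - cos θ ^ 2) * cosh_sq_sub_sinh_sq δ
  rw [h, sqrt_sq (div_nonneg (sin_nonneg_of_mem_Icc hθ) hD.le)]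

open Real in
theorem hasDerivAt_angular_update (δ : ℝ) {θ : ℝ} (hθ : θ ∈ Set.Ioo 0 π) :
    HasDerivAt
      (fun t ↦ arccos ((sinh δ + cos t * cosh δ) / (cosh δ + cos t * sinh δ)))
      (cosh δ + cos θ * sinh δ)⁻¹ θ := by
  have hD := cosh_add_mul_sinh_pos δ (cos_mem_Icc θ)
  have hs := sin_pos_of_mem_Ioo hθ
  have hsqrt := sqrt_one_sub_angular_update_sq δ (Set.Ioo_subset_Icc_self hθ)
  have hlt := sqrt_pos.mp (hsqrt ▸ div_pos hs hD)
  have hx := (((hasDerivAt_cos θ).mul_const (cosh δ)).const_add (sinh δ)).fun_div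
    (((hasDerivAt_cos θ).mul_const (sinh δ)).const_add (cosh δ)) hD.ne'
  refine ((hasDerivAt_arccos (fun h ↦ ?_) (fun h ↦ ?_)).comp θ hx).congr_deriv ?_
  · simp [h] at hlt
  · simp [h] at hlt
  · rw [hsqrt]
    field_simp
    linear_combination cosh_sq_sub_sinh_sq δ


/-- The Metropolis–Hastings ratio of the microcanonical velocity update in the
angular coordinate: the product of the density ratio `(sin θ'/sin θ)^(d-2)` and
the Jacobian `dθ'/dθ` equals `(cosh δ + cos θ sinh δ)^{-(d-1)}`, whose negative
logarithm is the kinetic energy change `(d-1) log(cosh δ + cos θ sinh δ)`. -/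
theorem angular_update_mh_ratio {d : ℕ} (hd : 2 ≤ d) (δ : ℝ) (θ' : ℝ → ℝ)
    (hθ' : ∀ θ, θ' θ = Real.arccos ((Real.sinh δ + Real.cos θ * Real.cosh δ) /
      (Real.cosh δ + Real.cos θ * Real.sinh δ)))
    (θ : ℝ) (hθ : θ ∈ Set.Ioo (0 : ℝ) Real.pi) :
    (Real.sin (θ' θ) / Real.sin θ) ^ (d - 2) * deriv θ' θ =
      ((Real.cosh δ + Real.cos θ * Real.sinh δ) ^ (d - 1))⁻¹ := by
  obtain rfl := funext hθ'
  have hs := (Real.sin_pos_of_mem_Ioo hθ).ne'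
  have hsin := sqrt_one_sub_angular_update_sq δ (Set.Ioo_subset_Icc_self hθ)
  rw [(hasDerivAt_angular_update δ hθ).deriv, Real.sin_arccos, hsin, div_right_comm,
    div_self hs, one_div, ← pow_succ, inv_pow, show d - 2 + 1 = d - 1 by omega]
end
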